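/- CEK correctness: for every program e, eval_CEK(e) = eval(e); that is, the CEK machine started at ⟨e, ∅, mt⟩ reaches a final state ⟨v, ρ, mt⟩ with real(v,ρ) = v' if and only if e reduces to v' under the reflexive-transitive closure of the standard call-by-value reduction. -/

import Mathlib

/-! # Core definitions: call-by-value λ-calculus, CEK, CESK*, timed and
abstract machines, and garbage collection machinery. -/

/-! ## Syntax -/

inductive Exp : Type where
  | var : ℕ → Exp
  | app : Exp → Exp → Exp
  | lam : ℕ → Exp → Exp
deriving DecidableEq

/-- Values are λ-abstractions. -/
def IsValue (e : Exp) : Prop := ∃ x b, e = Exp.lam x b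

/-- Free variables. -/
def fv : Exp → Finset ℕ
  | Exp.var x => {x}
  | Exp.app e₁ e₂ => fv e₁ ∪ fv e₂
  | Exp.lam x b => fv b \ {x}

/-- A program is a closed expression. -/
def Closed (e : Exp) : Prop := fv e = ∅

/-- Substitution `[v/x]e` (capture-avoiding when `v` is closed, as it is
in call-by-value evaluation of programs). -/
def subst (v : Exp) (x : ℕ) : Exp → Exp
  | Exp.var y => if y = x then v else Exp.var y
  | Exp.app e₁ e₂ => Exp.app (subst v x e₁) (subst v x e₂)
  | Exp.lam y b => if y = x then Exp.lam y b else Exp.lam y (subst v x b)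

/-- All variables occurring in an expression (free or bound). -/
def vars : Exp → Finset ℕ
  | Exp.var x => {x}
  | Exp.app e₁ e₂ => vars e₁ ∪ vars e₂
  | Exp.lam x b => insert x (vars b)

/-- All subexpressions of an expression. -/
def subExps : Exp → Finset Exp
  | Exp.var x => {Exp.var x}
  | Exp.app e₁ e₂ => insert (Exp.app e₁ e₂) (subExps e₁ ∪ subExps e₂)
  | Exp.lam x b => insert (Exp.lam x b) (subExps b)

/-! ## Reduction semantics -/

/-- Evaluation contexts `E ::= [] | (E e) | (v E)`. -/
inductive Ctx : Type where
  | hole : Ctx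
  | appL : Ctx → Exp → Ctx
  | appR : Exp → Ctx → Ctx

/-- Well-formed evaluation contexts: in `(v E)` the left part is a value. -/
inductive ECtx : Ctx → Prop where
  | hole : ECtx Ctx.hole
  | appL : ∀ (E : Ctx) (e : Exp), ECtx E → ECtx (Ctx.appL E e)
  | appR : ∀ (v : Exp) (E : Ctx), IsValue v → ECtx E → ECtx (Ctx.appR v E)

/-- Plugging an expression into the hole of a context. -/
def plug : Ctx → Exp → Exp
  | Ctx.hole, e => e
  | Ctx.appL E e', e => Exp.app (plug E e) e'
  | Ctx.appR v E, e => Exp.app v (plug E e)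

/-- The standard call-by-value reduction relation `E[(λx.b) v] ↦ E[[v/x]b]`. -/
inductive StdStep : Exp → Exp → Prop where
  | mk : ∀ (E : Ctx) (x : ℕ) (b v : Exp), ECtx E → IsValue v →
      StdStep (plug E (Exp.app (Exp.lam x b) v)) (plug E (subst v x b))

/-! ## Association-list finite maps -/

/-- Lookup in an association list. -/
def lookupA {β : Type} (ρ : List (ℕ × β)) (x : ℕ) : Option β :=
  (ρ.find? (fun p => p.1 == x)).map Prod.snd

/-- Finite-map update `ρ[x ↦ b]`. -/
def updA {β : Type} (ρ : List (ℕ × β)) (x : ℕ) (b : β) : List (ℕ × β) :=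
  (x, b) :: ρ.filter (fun p => p.1 != x)

/-- Removing a binding (used for shadowing under a binder). -/
def eraseA {β : Type} (ρ : List (ℕ × β)) (x : ℕ) : List (ℕ × β) :=
  ρ.filter (fun p => p.1 != x)

/-! ## The CEK machine -/

/-- Closures: a value paired with an environment. -/
inductive Clo : Type where
  | mk : Exp → List (ℕ × Clo) → Clo

/-- CEK environments map variables to closures. -/
abbrev CEnv : Type := List (ℕ × Clo)

/-- CEK continuations `κ ::= mt | ar(e,ρ,κ) | fn(v,ρ,κ)`. -/
inductive CKont : Type where
  | mt : CKont
  | ar : Exp → CEnv → CKont → CKont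
  | fn : Exp → CEnv → CKont → CKont

structure CEKState : Type where
  exp : Exp
  env : CEnv
  kont : CKont

/-- The CEK transition relation. -/
inductive CEKStep : CEKState → CEKState → Prop where
  | var : ∀ (x : ℕ) (ρ : CEnv) (κ : CKont) (v : Exp) (ρ' : CEnv),
      lookupA ρ x = some (Clo.mk v ρ') →
      CEKStep ⟨Exp.var x, ρ, κ⟩ ⟨v, ρ', κ⟩
  | app : ∀ (e₀ e₁ : Exp) (ρ : CEnv) (κ : CKont),
      CEKStep ⟨Exp.app e₀ e₁, ρ, κ⟩ ⟨e₀, ρ, CKont.ar e₁ ρ κ⟩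
  | ar : ∀ (v : Exp) (ρ : CEnv) (e : Exp) (ρ' : CEnv) (κ : CKont),
      IsValue v →
      CEKStep ⟨v, ρ, CKont.ar e ρ' κ⟩ ⟨e, ρ', CKont.fn v ρ κ⟩
  | fn : ∀ (v : Exp) (ρ : CEnv) (x : ℕ) (e : Exp) (ρ' : CEnv) (κ : CKont),
      IsValue v →
      CEKStep ⟨v, ρ, CKont.fn (Exp.lam x e) ρ' κ⟩ ⟨e, updA ρ' x (Clo.mk v ρ), κ⟩

/-- Initial CEK state. -/
def injCEK (e : Exp) : CEKState := ⟨e, [], CKont.mt⟩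

/-- `RealR v ρ e'` : performing the delayed substitutions recorded in `ρ`
on `v` yields `e'` (the `real` function, as a relation). -/
inductive RealR : Exp → CEnv → Exp → Prop where
  | varHit : ∀ (x : ℕ) (ρ : CEnv) (v : Exp) (ρ' : CEnv) (e' : Exp),
      lookupA ρ x = some (Clo.mk v ρ') → RealR v ρ' e' → RealR (Exp.var x) ρ e'
  | varMiss : ∀ (x : ℕ) (ρ : CEnv),
      lookupA ρ x = none → RealR (Exp.var x) ρ (Exp.var x)
  | app : ∀ (e₀ e₁ : Exp) (ρ : CEnv) (e₀' e₁' : Exp),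
      RealR e₀ ρ e₀' → RealR e₁ ρ e₁' →
      RealR (Exp.app e₀ e₁) ρ (Exp.app e₀' e₁')
  | lam : ∀ (x : ℕ) (b : Exp) (ρ : CEnv) (b' : Exp),
      RealR b (eraseA ρ x) b' → RealR (Exp.lam x b) ρ (Exp.lam x b')

/-! ## The CESK* machine (generic in the type of addresses) -/

/-- Environments mapping variables to addresses. -/
abbrev PEnv (A : Type) : Type := List (ℕ × A)

/-- Continuations with store pointers `κ ::= mt | ar(e,ρ,a) | fn(v,ρ,a)`. -/
inductive Kont (A : Type) : Type where
  | mt : Kont A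
  | ar : Exp → PEnv A → A → Kont A
  | fn : Exp → PEnv A → A → Kont A

/-- Storable values: closures and continuations. -/
inductive Storable (A : Type) : Type where
  | clo : Exp → PEnv A → Storable A
  | kont : Kont A → Storable A

/-- Stores: partial maps from addresses to storables. -/
abbrev Store (A : Type) : Type := A → Option (Storable A)

/-- Store update `σ[b ↦ s]`. -/
def Store.upd {A : Type} [DecidableEq A] (σ : Store A) (b : A) (s : Storable A) : Store A :=
  fun a => if a = b then some s else σ a

structure CeskState (A : Type) : Type where
  exp : Exp
  env : PEnv A
  sto : Store A
  kptr : A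

/-- The CESK* transition relation (the fresh address `b` with `σ b = none`
is chosen nondeterministically; `κ = σ(a)` is the current continuation). -/
inductive CeskStep {A : Type} [DecidableEq A] : CeskState A → CeskState A → Prop where
  | var : ∀ (x : ℕ) (ρ : PEnv A) (σ : Store A) (a : A) (κ : Kont A) (l : A)
      (v : Exp) (ρ' : PEnv A),
      σ a = some (Storable.kont κ) →
      lookupA ρ x = some l → σ l = some (Storable.clo v ρ') →
      CeskStep ⟨Exp.var x, ρ, σ, a⟩ ⟨v, ρ', σ, a⟩
  | app : ∀ (e₀ e₁ : Exp) (ρ : PEnv A) (σ : Store A) (a : A) (κ : Kont A) (b : A),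
      σ a = some (Storable.kont κ) → σ b = none →
      CeskStep ⟨Exp.app e₀ e₁, ρ, σ, a⟩
        ⟨e₀, ρ, Store.upd σ b (Storable.kont (Kont.ar e₁ ρ a)), b⟩
  | ar : ∀ (v : Exp) (ρ : PEnv A) (σ : Store A) (a : A) (e : Exp) (ρ' : PEnv A)
      (c : A) (b : A),
      IsValue v → σ a = some (Storable.kont (Kont.ar e ρ' c)) → σ b = none →
      CeskStep ⟨v, ρ, σ, a⟩
        ⟨e, ρ', Store.upd σ b (Storable.kont (Kont.fn v ρ c)), b⟩
  | fn : ∀ (v : Exp) (ρ : PEnv A) (σ : Store A) (a : A) (x : ℕ) (e : Exp)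
      (ρ' : PEnv A) (c : A) (b : A),
      IsValue v → σ a = some (Storable.kont (Kont.fn (Exp.lam x e) ρ' c)) → σ b = none →
      CeskStep ⟨v, ρ, σ, a⟩
        ⟨e, updA ρ' x b, Store.upd σ b (Storable.clo v ρ), c⟩

/-- The initial store `[a₀ ↦ mt]`. -/
def initStore {A : Type} [DecidableEq A] (a₀ : A) : Store A :=
  fun a => if a = a₀ then some (Storable.kont Kont.mt) else none

/-- Initial CESK* state. -/
def injCesk {A : Type} [DecidableEq A] (a₀ : A) (e : Exp) : CeskState A :=
  ⟨e, [], initStore a₀, a₀⟩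

/-- The `real` function of the CESK* machine: `RealP σ v ρ e'` means that
unfolding the delayed substitutions of `ρ` on `v`, following the
indirection through the store `σ`, yields `e'`. -/
inductive RealP {A : Type} (σ : Store A) : Exp → PEnv A → Exp → Prop where
  | varHit : ∀ (x : ℕ) (ρ : PEnv A) (l : A) (v : Exp) (ρ' : PEnv A) (e' : Exp),
      lookupA ρ x = some l → σ l = some (Storable.clo v ρ') →
      RealP σ v ρ' e' → RealP σ (Exp.var x) ρ e'
  | varMiss : ∀ (x : ℕ) (ρ : PEnv A),
      lookupA ρ x = none → RealP σ (Exp.var x) ρ (Exp.var x)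
  | app : ∀ (e₀ e₁ : Exp) (ρ : PEnv A) (e₀' e₁' : Exp),
      RealP σ e₀ ρ e₀' → RealP σ e₁ ρ e₁' →
      RealP σ (Exp.app e₀ e₁) ρ (Exp.app e₀' e₁')
  | lam : ∀ (x : ℕ) (b : Exp) (ρ : PEnv A) (b' : Exp),
      RealP σ b (eraseA ρ x) b' → RealP σ (Exp.lam x b) ρ (Exp.lam x b')

/-! ## Renaming of addresses -/

def renEnv {A B : Type} (f : A → B) (ρ : PEnv A) : PEnv B :=
  ρ.map (fun p => (p.1, f p.2))

def Kont.ren {A B : Type} (f : A → B) : Kont A → Kont B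
  | Kont.mt => Kont.mt
  | Kont.ar e ρ a => Kont.ar e (renEnv f ρ) (f a)
  | Kont.fn v ρ a => Kont.fn v (renEnv f ρ) (f a)

def Storable.ren {A B : Type} (f : A → B) : Storable A → Storable B
  | Storable.clo v ρ => Storable.clo v (renEnv f ρ)
  | Storable.kont κ => Storable.kont (Kont.ren f κ)

/-- Renaming a store along a bijection of addresses. -/
def Store.ren {A : Type} (π : A ≃ A) (σ : Store A) : Store A :=
  fun a => (σ (π.symm a)).map (Storable.ren π)

/-- A consistent renaming of addresses, applied uniformly throughout a state. -/
def CeskState.ren {A : Type} (π : A ≃ A) (ς : CeskState A) : CeskState A :=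
  ⟨ς.exp, renEnv π ς.env, Store.ren π ς.sto, π ς.kptr⟩

/-! ## The time-stamped CESK* machine -/

structure TState (A T : Type) : Type where
  exp : Exp
  env : PEnv A
  sto : Store A
  kptr : A
  time : T

/-- The time-stamped CESK* transition relation, parameterized by `alloc`
and `tick`. -/
inductive TStep {A T : Type} [DecidableEq A]
    (alloc : TState A T → A) (tick : TState A T → T) :
    TState A T → TState A T → Prop where
  | var : ∀ (x : ℕ) (ρ : PEnv A) (σ : Store A) (a : A) (t : T) (κ : Kont A)
      (l : A) (v : Exp) (ρ' : PEnv A),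
      σ a = some (Storable.kont κ) →
      lookupA ρ x = some l → σ l = some (Storable.clo v ρ') →
      TStep alloc tick ⟨Exp.var x, ρ, σ, a, t⟩
        ⟨v, ρ', σ, a, tick ⟨Exp.var x, ρ, σ, a, t⟩⟩
  | app : ∀ (e₀ e₁ : Exp) (ρ : PEnv A) (σ : Store A) (a : A) (t : T) (κ : Kont A),
      σ a = some (Storable.kont κ) →
      TStep alloc tick ⟨Exp.app e₀ e₁, ρ, σ, a, t⟩
        ⟨e₀, ρ,
         Store.upd σ (alloc ⟨Exp.app e₀ e₁, ρ, σ, a, t⟩)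
           (Storable.kont (Kont.ar e₁ ρ a)),
         alloc ⟨Exp.app e₀ e₁, ρ, σ, a, t⟩, tick ⟨Exp.app e₀ e₁, ρ, σ, a, t⟩⟩
  | ar : ∀ (v : Exp) (ρ : PEnv A) (σ : Store A) (a : A) (t : T) (e : Exp)
      (ρ' : PEnv A) (c : A),
      IsValue v → σ a = some (Storable.kont (Kont.ar e ρ' c)) →
      TStep alloc tick ⟨v, ρ, σ, a, t⟩
        ⟨e, ρ',
         Store.upd σ (alloc ⟨v, ρ, σ, a, t⟩) (Storable.kont (Kont.fn v ρ c)),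
         alloc ⟨v, ρ, σ, a, t⟩, tick ⟨v, ρ, σ, a, t⟩⟩
  | fn : ∀ (v : Exp) (ρ : PEnv A) (σ : Store A) (a : A) (t : T) (x : ℕ)
      (e : Exp) (ρ' : PEnv A) (c : A),
      IsValue v → σ a = some (Storable.kont (Kont.fn (Exp.lam x e) ρ' c)) →
      TStep alloc tick ⟨v, ρ, σ, a, t⟩
        ⟨e, updA ρ' x (alloc ⟨v, ρ, σ, a, t⟩),
         Store.upd σ (alloc ⟨v, ρ, σ, a, t⟩) (Storable.clo v ρ), c,
         tick ⟨v, ρ, σ, a, t⟩⟩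

/-- Initial time-stamped CESK* state. -/
def injT {A T : Type} [DecidableEq A] (a₀ : A) (t₀ : T) (e : Exp) : TState A T :=
  ⟨e, [], initStore a₀, a₀, t₀⟩

/-- Erasing the time stamp. -/
def eraseT {A T : Type} (ς : TState A T) : CeskState A :=
  ⟨ς.exp, ς.env, ς.sto, ς.kptr⟩

/-- Correspondence between time-stamped and plain CESK* states: equality
after erasing the time stamp, up to a consistent renaming of addresses. -/
def TCorr {A T : Type} (ς : TState A T) (ς' : CeskState A) : Prop :=
  ∃ π : A ≃ A, CeskState.ren π (eraseT ς) = ς'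

/-! ## The abstract time-stamped CESK* machine -/

/-- Abstract stores map addresses to *sets* of storables. -/
abbrev AStore (A : Type) : Type := A → Set (Storable A)

/-- Pointwise order on abstract stores. -/
def AStore.le {A : Type} (σ₁ σ₂ : AStore A) : Prop := ∀ a, σ₁ a ⊆ σ₂ a

/-- Store join `σ ⊔ [b ↦ s]`. -/
def AStore.join {A : Type} [DecidableEq A] (σ : AStore A) (b : A) (s : Storable A) :
    AStore A :=
  fun a => if a = b then insert s (σ a) else σ a

/-- Abstraction of a concrete store along an abstraction of addresses:
`α(σ) = λâ.⊔_{α(a)=â} {α(σ(a))}`. -/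
def absStore {A B : Type} (αA : A → B) (σ : Store A) : AStore B :=
  fun b => { s' | ∃ (a : A) (s : Storable A), αA a = b ∧ σ a = some s ∧ s' = Storable.ren αA s }

structure AState (A T : Type) : Type where
  exp : Exp
  env : PEnv A
  sto : AStore A
  kptr : A
  time : T

/-- Abstraction map on time-stamped states, acting componentwise. -/
def αTS {A T B S : Type} (αA : A → B) (αT : T → S) (ς : TState A T) : AState B S :=
  ⟨ς.exp, renEnv αA ς.env, absStore αA ς.sto, αA ς.kptr, αT ς.time⟩

/-- The order `⊑` on abstract states: pointwise/memberwise on stores, the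
given order on times, and flat (equality) on the other components. -/
def AState.le {A T : Type} [Preorder T] (ς₁ ς₂ : AState A T) : Prop :=
  ς₁.exp = ς₂.exp ∧ ς₁.env = ς₂.env ∧ AStore.le ς₁.sto ς₂.sto ∧
    ς₁.kptr = ς₂.kptr ∧ ς₁.time ≤ ς₂.time

/-- The abstract time-stamped CESK* transition relation, parameterized by
`alloĉ` and `tick̂` (which take the state together with the chosen
continuation `κ ∈ σ̂(a)`). -/
inductive AStep {A T : Type} [DecidableEq A]
    (allocA : AState A T → Kont A → A) (tickA : AState A T → Kont A → T) :
    AState A T → AState A T → Prop where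
  | var : ∀ (x : ℕ) (ρ : PEnv A) (σ : AStore A) (a : A) (t : T) (κ : Kont A)
      (l : A) (v : Exp) (ρ' : PEnv A),
      Storable.kont κ ∈ σ a → lookupA ρ x = some l →
      Storable.clo v ρ' ∈ σ l →
      AStep allocA tickA ⟨Exp.var x, ρ, σ, a, t⟩
        ⟨v, ρ', σ, a, tickA ⟨Exp.var x, ρ, σ, a, t⟩ κ⟩
  | app : ∀ (e₀ e₁ : Exp) (ρ : PEnv A) (σ : AStore A) (a : A) (t : T) (κ : Kont A),
      Storable.kont κ ∈ σ a →
      AStep allocA tickA ⟨Exp.app e₀ e₁, ρ, σ, a, t⟩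
        ⟨e₀, ρ,
         AStore.join σ (allocA ⟨Exp.app e₀ e₁, ρ, σ, a, t⟩ κ)
           (Storable.kont (Kont.ar e₁ ρ a)),
         allocA ⟨Exp.app e₀ e₁, ρ, σ, a, t⟩ κ,
         tickA ⟨Exp.app e₀ e₁, ρ, σ, a, t⟩ κ⟩
  | ar : ∀ (v : Exp) (ρ : PEnv A) (σ : AStore A) (a : A) (t : T) (e : Exp)
      (ρ' : PEnv A) (c : A),
      IsValue v → Storable.kont (Kont.ar e ρ' c) ∈ σ a →
      AStep allocA tickA ⟨v, ρ, σ, a, t⟩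
        ⟨e, ρ',
         AStore.join σ (allocA ⟨v, ρ, σ, a, t⟩ (Kont.ar e ρ' c))
           (Storable.kont (Kont.fn v ρ c)),
         allocA ⟨v, ρ, σ, a, t⟩ (Kont.ar e ρ' c),
         tickA ⟨v, ρ, σ, a, t⟩ (Kont.ar e ρ' c)⟩
  | fn : ∀ (v : Exp) (ρ : PEnv A) (σ : AStore A) (a : A) (t : T) (x : ℕ)
      (e : Exp) (ρ' : PEnv A) (c : A),
      IsValue v → Storable.kont (Kont.fn (Exp.lam x e) ρ' c) ∈ σ a →
      AStep allocA tickA ⟨v, ρ, σ, a, t⟩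
        ⟨e, updA ρ' x (allocA ⟨v, ρ, σ, a, t⟩ (Kont.fn (Exp.lam x e) ρ' c)),
         AStore.join σ (allocA ⟨v, ρ, σ, a, t⟩ (Kont.fn (Exp.lam x e) ρ' c))
           (Storable.clo v ρ),
         c, tickA ⟨v, ρ, σ, a, t⟩ (Kont.fn (Exp.lam x e) ρ' c)⟩

/-! ## Correspondence between CEK states and (time-stamped) CESK* states -/

/-- `EnvC σ ρp ρ`: the pointer environment `ρp` corresponds, through the
store `σ`, to the CEK environment `ρ`. -/
inductive EnvC {A : Type} (σ : Store A) : PEnv A → CEnv → Prop where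
  | nil : EnvC σ [] []
  | cons : ∀ (x : ℕ) (l : A) (v : Exp) (ρp' : PEnv A) (ρ' : CEnv)
      (ρp : PEnv A) (ρ : CEnv),
      σ l = some (Storable.clo v ρp') → EnvC σ ρp' ρ' → EnvC σ ρp ρ →
      EnvC σ ((x, l) :: ρp) ((x, Clo.mk v ρ') :: ρ)

/-- `KontC σ a κ`: the continuation pointer `a` corresponds, through the
store `σ`, to the CEK continuation `κ`. -/
inductive KontC {A : Type} (σ : Store A) : A → CKont → Prop where
  | mt : ∀ (a : A), σ a = some (Storable.kont Kont.mt) → KontC σ a CKont.mt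
  | ar : ∀ (a : A) (e : Exp) (ρp : PEnv A) (c : A) (ρ : CEnv) (κ : CKont),
      σ a = some (Storable.kont (Kont.ar e ρp c)) →
      EnvC σ ρp ρ → KontC σ c κ → KontC σ a (CKont.ar e ρ κ)
  | fn : ∀ (a : A) (v : Exp) (ρp : PEnv A) (c : A) (ρ : CEnv) (κ : CKont),
      σ a = some (Storable.kont (Kont.fn v ρp c)) →
      EnvC σ ρp ρ → KontC σ c κ → KontC σ a (CKont.fn v ρ κ)

/-- The lock-step correspondence between a CEK state and a time-stamped
CESK* state. -/
def StateC {A T : Type} (ς : CEKState) (ςt : TState A T) : Prop :=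
  ς.exp = ςt.exp ∧ EnvC ςt.sto ςt.env ς.env ∧ KontC ςt.sto ςt.kptr ς.kont

/-! ## Well-formed abstract states over a program (for finiteness) -/

def WFEnv {A : Type} (e : Exp) (ρ : PEnv A) : Prop :=
  (ρ.map Prod.fst).Nodup ∧ ∀ p ∈ ρ, p.1 ∈ vars e

def WFKont {A : Type} (e : Exp) : Kont A → Prop
  | Kont.mt => True
  | Kont.ar e' ρ _ => e' ∈ subExps e ∧ WFEnv e ρ
  | Kont.fn v ρ _ => v ∈ subExps e ∧ WFEnv e ρ

def WFStorable {A : Type} (e : Exp) : Storable A → Prop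
  | Storable.clo v ρ => v ∈ subExps e ∧ WFEnv e ρ
  | Storable.kont κ => WFKont e κ

/-- Abstract states all of whose components are built from the (finitely
many) subexpressions and variables of the program `e`. -/
def WFState {A T : Type} (e : Exp) (ς : AState A T) : Prop :=
  ς.exp ∈ subExps e ∧ WFEnv e ς.env ∧
    ∀ (a : A) (s : Storable A), s ∈ ς.sto a → WFStorable e s

/-- The abstraction of the initial time-stamped CESK* state, as an
abstract state. -/
def injA {A T : Type} [DecidableEq A] (a₀ : A) (t₀ : T) (e : Exp) : AState A T :=
  ⟨e, [], fun a => if a = a₀ then {Storable.kont Kont.mt} else ∅, a₀, t₀⟩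

/-! ## Garbage collection -/

/-- `envLive ρ e` : the range of `ρ` restricted to the free variables of
`e` — the live locations `L_σ(e,ρ)` contributed by a closure. -/
def envLive {A : Type} (ρ : PEnv A) (e : Exp) : Set A :=
  { l | ∃ x ∈ fv e, lookupA ρ x = some l }

/-- `LiveIn σ s l` : the address `l` is among the live locations
`L_σ(s)` of the storable `s` (least fixed point). -/
inductive LiveIn {A : Type} (σ : Store A) : Storable A → A → Prop where
  | clo : ∀ (v : Exp) (ρ : PEnv A) (l : A),
      l ∈ envLive ρ v → LiveIn σ (Storable.clo v ρ) l
  | arSelf : ∀ (e : Exp) (ρ : PEnv A) (a : A),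
      LiveIn σ (Storable.kont (Kont.ar e ρ a)) a
  | arEnv : ∀ (e : Exp) (ρ : PEnv A) (a : A) (l : A),
      l ∈ envLive ρ e → LiveIn σ (Storable.kont (Kont.ar e ρ a)) l
  | arRec : ∀ (e : Exp) (ρ : PEnv A) (a : A) (s : Storable A) (l : A),
      σ a = some s → LiveIn σ s l → LiveIn σ (Storable.kont (Kont.ar e ρ a)) l
  | fnSelf : ∀ (v : Exp) (ρ : PEnv A) (a : A),
      LiveIn σ (Storable.kont (Kont.fn v ρ a)) a
  | fnEnv : ∀ (v : Exp) (ρ : PEnv A) (a : A) (l : A),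
      l ∈ envLive ρ v → LiveIn σ (Storable.kont (Kont.fn v ρ a)) l
  | fnRec : ∀ (v : Exp) (ρ : PEnv A) (a : A) (s : Storable A) (l : A),
      σ a = some s → LiveIn σ s l → LiveIn σ (Storable.kont (Kont.fn v ρ a)) l

/-- `L_σ(σ(a))`, the live locations of the storable at address `a`. -/
def liveOfAddr {A : Type} (σ : Store A) (a : A) : Set A :=
  { l | ∃ s : Storable A, σ a = some s ∧ LiveIn σ s l }

/-- States of the GC machine: grey locations, black locations, store. -/
structure GCState (A : Type) : Type where
  grey : Set A
  black : Set A
  sto : Store A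

/-- The GC machine transition. -/
inductive GCStep {A : Type} : GCState A → GCState A → Prop where
  | mk : ∀ (G B : Set A) (σ : Store A) (a : A),
      a ∈ G →
      GCStep ⟨G, B, σ⟩ ⟨(G ∪ liveOfAddr σ a) \ (insert a B), insert a B, σ⟩

/-- The set of store locations reachable from the initial grey set `G₀`:
the least set containing `G₀` and closed under `a ↦ L_σ(σ(a))`. -/
inductive ReachAddr {A : Type} (σ : Store A) (G₀ : Set A) : A → Prop where
  | base : ∀ (a : A), a ∈ G₀ → ReachAddr σ G₀ a
  | step : ∀ (a l : A), ReachAddr σ G₀ a → l ∈ liveOfAddr σ a → ReachAddr σ G₀ l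

-- Restriction of a store to a set of live locations.
open Classical in
noncomputable def Store.restrict {A : Type} (σ : Store A) (L : Set A) : Store A :=
  fun l => if l ∈ L then σ l else none

/-- The GC transition of the CESK* machine. -/
inductive CGCTrans {A : Type} : CeskState A → CeskState A → Prop where
  | mk : ∀ (e : Exp) (ρ : PEnv A) (σ : Store A) (a : A) (L : Set A),
      Relation.ReflTransGen GCStep
        ⟨envLive ρ e ∪ liveOfAddr σ a, {a}, σ⟩ ⟨∅, L, σ⟩ →
      CGCTrans ⟨e, ρ, σ, a⟩ ⟨e, ρ, Store.restrict σ L, a⟩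

/-! ### Abstract garbage collection -/

/-- Live locations of an abstract storable in an abstract store (with the
live-location function extended to the sets of storables stored at an
address by taking unions). -/
inductive ALiveIn {A : Type} (σ : AStore A) : Storable A → A → Prop where
  | clo : ∀ (v : Exp) (ρ : PEnv A) (l : A),
      l ∈ envLive ρ v → ALiveIn σ (Storable.clo v ρ) l
  | arSelf : ∀ (e : Exp) (ρ : PEnv A) (a : A),
      ALiveIn σ (Storable.kont (Kont.ar e ρ a)) a
  | arEnv : ∀ (e : Exp) (ρ : PEnv A) (a : A) (l : A),
      l ∈ envLive ρ e → ALiveIn σ (Storable.kont (Kont.ar e ρ a)) l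
  | arRec : ∀ (e : Exp) (ρ : PEnv A) (a : A) (s : Storable A) (l : A),
      s ∈ σ a → ALiveIn σ s l → ALiveIn σ (Storable.kont (Kont.ar e ρ a)) l
  | fnSelf : ∀ (v : Exp) (ρ : PEnv A) (a : A),
      ALiveIn σ (Storable.kont (Kont.fn v ρ a)) a
  | fnEnv : ∀ (v : Exp) (ρ : PEnv A) (a : A) (l : A),
      l ∈ envLive ρ v → ALiveIn σ (Storable.kont (Kont.fn v ρ a)) l
  | fnRec : ∀ (v : Exp) (ρ : PEnv A) (a : A) (s : Storable A) (l : A),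
      s ∈ σ a → ALiveIn σ s l → ALiveIn σ (Storable.kont (Kont.fn v ρ a)) l

/-- `L_σ̂(σ̂(â))`, the live locations of the set of storables at `â`. -/
def aliveOfAddr {A : Type} (σ : AStore A) (a : A) : Set A :=
  { l | ∃ s ∈ σ a, ALiveIn σ s l }

structure AGCState (A : Type) : Type where
  grey : Set A
  black : Set A
  sto : AStore A

inductive AGCStep {A : Type} : AGCState A → AGCState A → Prop where
  | mk : ∀ (G B : Set A) (σ : AStore A) (a : A),
      a ∈ G →
      AGCStep ⟨G, B, σ⟩ ⟨(G ∪ aliveOfAddr σ a) \ (insert a B), insert a B, σ⟩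

-- Restriction of an abstract store to a set of live locations.
open Classical in
noncomputable def AStore.restrict {A : Type} (σ : AStore A) (L : Set A) : AStore A :=
  fun l => if l ∈ L then σ l else ∅

/-- Abstract CESK* states (no time stamps), for abstract GC. -/
structure ACeskState (A : Type) : Type where
  exp : Exp
  env : PEnv A
  sto : AStore A
  kptr : A

/-- Abstraction map on CESK* states. -/
def αCS {A B : Type} (αA : A → B) (ς : CeskState A) : ACeskState B :=
  ⟨ς.exp, renEnv αA ς.env, absStore αA ς.sto, αA ς.kptr⟩

def ACeskState.le {A : Type} (ς₁ ς₂ : ACeskState A) : Prop :=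
  ς₁.exp = ς₂.exp ∧ ς₁.env = ς₂.env ∧ AStore.le ς₁.sto ς₂.sto ∧ ς₁.kptr = ς₂.kptr

/-- The abstract GC transition. -/
inductive AGCTrans {A : Type} : ACeskState A → ACeskState A → Prop where
  | mk : ∀ (e : Exp) (ρ : PEnv A) (σ : AStore A) (a : A) (L : Set A),
      Relation.ReflTransGen AGCStep
        ⟨envLive ρ e ∪ aliveOfAddr σ a, {a}, σ⟩ ⟨∅, L, σ⟩ →
      AGCTrans ⟨e, ρ, σ, a⟩ ⟨e, ρ, AStore.restrict σ L, a⟩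

/-! ## Finite maps and substitution -/

theorem lookupA_eraseA {β : Type} (ρ : List (ℕ × β)) (x y : ℕ) :
    lookupA (eraseA ρ x) y = if y = x then none else lookupA ρ y := by
  induction ρ with
  | nil => simp [lookupA, eraseA]
  | cons p ρ ih =>
    simp only [lookupA, eraseA, List.filter_cons, List.find?_cons] at ih ⊢
    grind

theorem lookupA_updA {β : Type} (ρ : List (ℕ × β)) (x y : ℕ) (b : β) :
    lookupA (updA ρ x b) y = if y = x then some b else lookupA ρ y := by
  have h := lookupA_eraseA ρ x y
  simp only [lookupA, updA, eraseA, List.find?_cons] at h ⊢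
  grind

theorem subst_of_notMem_fv {v : Exp} {x : ℕ} {e : Exp} (h : x ∉ fv e) : subst v x e = e := by
  induction e with
  | var y => simp [fv] at h; simp [subst, Ne.symm h]
  | app e₁ e₂ ih₁ ih₂ => simp [fv] at h; simp [subst, ih₁ h.1, ih₂ h.2]
  | lam y b ih => simp [fv] at h; simp only [subst]; grind

theorem Closed.subst_eq {e : Exp} (h : Closed e) (v : Exp) (x : ℕ) : subst v x e = e :=
  subst_of_notMem_fv (by simp [show fv e = ∅ from h])

theorem fv_subst {v : Exp} (hv : Closed v) (x : ℕ) (e : Exp) : fv (subst v x e) = fv e \ {x} := by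
  unfold Closed at hv
  induction e with
  | var y =>
    by_cases h : y = x
    · simp [subst, fv, h, hv]
    · simp [subst, fv, h, Finset.sdiff_singleton_eq_erase, Ne.symm h]
  | app e₁ e₂ ih₁ ih₂ => simp [subst, fv, ih₁, ih₂, Finset.union_sdiff_distrib]
  | lam y b ih =>
    by_cases h : y = x
    · simp [subst, fv, h]
    · simp only [subst, fv, h, if_false, ih]
      exact sdiff_right_comm ..

theorem closed_app {e₁ e₂ : Exp} : Closed (Exp.app e₁ e₂) ↔ Closed e₁ ∧ Closed e₂ := by
  simp [Closed, fv, Finset.union_eq_empty]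

theorem Closed.subst_body {x : ℕ} {b v : Exp} (hb : Closed (Exp.lam x b)) (hv : Closed v) :
    Closed (subst v x b) := by
  unfold Closed
  rw [fv_subst hv]
  exact hb

/-! ## Properties of `RealR` -/

theorem RealR.congr {e e' : Exp} {ρ ρ' : CEnv} (h : RealR e ρ e')
    (hρ : ∀ y, lookupA ρ' y = lookupA ρ y) : RealR e ρ' e' := by
  induction h generalizing ρ' with
  | varHit x ρ v ρ₁ e' hx hr _ => exact .varHit x ρ' v ρ₁ e' (by rw [hρ, hx]) hr
  | varMiss x ρ hx => exact .varMiss x ρ' (by rw [hρ, hx])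
  | app e₀ e₁ ρ e₀' e₁' _ _ ih₀ ih₁ => exact .app _ _ _ _ _ (ih₀ hρ) (ih₁ hρ)
  | lam x b ρ b' _ ih => exact .lam _ _ _ _ (ih fun y => by simp [lookupA_eraseA, hρ])

theorem RealR.unique {e e₁ e₂ : Exp} {ρ : CEnv} (h₁ : RealR e ρ e₁) (h₂ : RealR e ρ e₂) :
    e₁ = e₂ := by
  induction h₁ generalizing e₂ with
  | varHit x ρ v ρ₁ e' hx _ ih =>
    cases h₂ with
    | varHit _ _ v₂ ρ₂ _ hx₂ hr₂ =>
      obtain ⟨rfl, rfl⟩ : v = v₂ ∧ ρ₁ = ρ₂ := by simpa [hx] using hx₂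
      exact ih hr₂
    | varMiss _ _ hx₂ => simp [hx] at hx₂
  | varMiss x ρ hx =>
    cases h₂ with
    | varHit _ _ _ _ _ hx₂ _ => simp [hx] at hx₂
    | varMiss => rfl
  | app e₀ e₁ ρ e₀' e₁' _ _ ih₀ ih₁ =>
    cases h₂ with
    | app _ _ _ _ _ h₀ h₁ => rw [ih₀ h₀, ih₁ h₁]
  | lam x b ρ b' _ ih =>
    cases h₂ with
    | lam _ _ _ _ hb => rw [ih hb]

theorem RealR.nil (e : Exp) {ρ : CEnv} (hρ : ∀ y, lookupA ρ y = none) : RealR e ρ e := by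
  induction e generalizing ρ with
  | var x => exact .varMiss x ρ (hρ x)
  | app e₁ e₂ ih₁ ih₂ => exact .app _ _ _ _ _ (ih₁ hρ) (ih₂ hρ)
  | lam x b ih => exact .lam _ _ _ _ (ih fun y => by simp [lookupA_eraseA, hρ])

theorem RealR.isValue {e e' : Exp} {ρ : CEnv} (h : RealR e ρ e') (he : IsValue e) :
    IsValue e' := by
  obtain ⟨x, b, rfl⟩ := he
  cases h with
  | lam _ _ _ b' _ => exact ⟨x, b', rfl⟩

/-- Extending an environment with a binding for `x` amounts to substituting the realization of
that binding, provided that the other bindings realize to closed expressions. -/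
theorem RealR.subst {e e' v w : Exp} {x : ℕ} {ρ ρ₁ ρ₂ : CEnv} (h : RealR e ρ₁ e')
    (hcl : ∀ y u ρ' u', lookupA ρ₁ y = some (Clo.mk u ρ') → RealR u ρ' u' → Closed u')
    (hw : RealR v ρ w) (hx₁ : lookupA ρ₁ x = none) (hx₂ : lookupA ρ₂ x = some (Clo.mk v ρ))
    (hne : ∀ y, y ≠ x → lookupA ρ₂ y = lookupA ρ₁ y) : RealR e ρ₂ (subst w x e') := by
  induction h generalizing ρ₂ with
  | varHit y ρ₁ u ρ' u' hy hr _ =>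
    have hyx : y ≠ x := by rintro rfl; simp [hx₁] at hy
    rw [(hcl y u ρ' u' hy hr).subst_eq]
    exact .varHit y ρ₂ u ρ' u' (by rw [hne y hyx, hy]) hr
  | varMiss y ρ₁ hy =>
    by_cases hyx : y = x
    · subst hyx
      simpa [_root_.subst] using RealR.varHit y ρ₂ v ρ w hx₂ hw
    · simpa [_root_.subst, hyx] using RealR.varMiss y ρ₂ (by rw [hne y hyx, hy])
  | app e₀ e₁ ρ₁ e₀' e₁' _ _ ih₀ ih₁ =>
    exact .app _ _ _ _ _ (ih₀ hcl hx₁ hx₂ hne) (ih₁ hcl hx₁ hx₂ hne)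
  | lam y b ρ₁ b' hb ih =>
    by_cases hyx : y = x
    · subst hyx
      simp only [_root_.subst, if_true]
      refine .lam _ _ _ _ (hb.congr fun z => ?_)
      simp only [lookupA_eraseA]
      split_ifs with hz
      · rfl
      · exact hne z hz
    · simp only [_root_.subst, hyx, if_false]
      refine .lam _ _ _ _ (ih ?_ ?_ ?_ ?_)
      · intro z u ρ' u' hz hr
        rw [lookupA_eraseA] at hz
        split_ifs at hz
        exact hcl z u ρ' u' hz hr
      · simp [lookupA_eraseA, hx₁]
      · rw [lookupA_eraseA, if_neg (Ne.symm hyx), hx₂]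
      · intro z hz
        simp [lookupA_eraseA, hne z hz]

/-! ## Well-formed closures and continuations -/

/-- Environments that hereditarily bind variables to values with closed realizations. -/
inductive EnvOK : CEnv → Prop where
  | mk : ∀ ρ : CEnv,
      (∀ y v ρ', lookupA ρ y = some (Clo.mk v ρ') → EnvOK ρ') →
      (∀ y v ρ', lookupA ρ y = some (Clo.mk v ρ') →
        IsValue v ∧ ∃ v', RealR v ρ' v' ∧ Closed v') →
      EnvOK ρ

/-- The expression `e` in the well-formed environment `ρ` realizes to the closed expression
`e'`. -/
structure Realizes (e : Exp) (ρ : CEnv) (e' : Exp) : Prop where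
  env : EnvOK ρ
  real : RealR e ρ e'
  closed : Closed e'

theorem EnvOK.lookup {ρ ρ' : CEnv} {y : ℕ} {v : Exp} (h : EnvOK ρ)
    (hy : lookupA ρ y = some (Clo.mk v ρ')) : IsValue v ∧ ∃ v', Realizes v ρ' v' := by
  obtain ⟨_, h₁, h₂⟩ := h
  obtain ⟨hv, v', hr, hc⟩ := h₂ y v ρ' hy
  exact ⟨hv, v', h₁ y v ρ' hy, hr, hc⟩

theorem Realizes.init {e : Exp} (he : Closed e) : Realizes e [] e :=
  ⟨.mk _ (by simp [lookupA]) (by simp [lookupA]), RealR.nil e (by simp [lookupA]), he⟩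

theorem Realizes.var {x : ℕ} {ρ : CEnv} {e' : Exp} (h : Realizes (Exp.var x) ρ e') :
    ∃ v ρ', lookupA ρ x = some (Clo.mk v ρ') ∧ IsValue v ∧ Realizes v ρ' e' := by
  obtain ⟨hρ, hr, hc⟩ := h
  cases hr with
  | varHit _ _ v ρ' _ hx hr =>
    obtain ⟨hv, v', hv'⟩ := hρ.lookup hx
    exact ⟨v, ρ', hx, hv, hv'.env, hr, hc⟩
  | varMiss => simp [Closed, fv] at hc

theorem Realizes.app {e₀ e₁ e' : Exp} {ρ : CEnv} (h : Realizes (Exp.app e₀ e₁) ρ e') :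
    ∃ e₀' e₁', e' = Exp.app e₀' e₁' ∧ Realizes e₀ ρ e₀' ∧ Realizes e₁ ρ e₁' := by
  obtain ⟨hρ, hr, hc⟩ := h
  cases hr with
  | app _ _ _ e₀' e₁' h₀ h₁ =>
    rw [closed_app] at hc
    exact ⟨e₀', e₁', rfl, ⟨hρ, h₀, hc.1⟩, ⟨hρ, h₁, hc.2⟩⟩

theorem Realizes.lam {x : ℕ} {b e' : Exp} {ρ : CEnv} (h : Realizes (Exp.lam x b) ρ e') :
    ∃ b', e' = Exp.lam x b' := by
  cases h.real with
  | lam _ _ _ b' _ => exact ⟨b', rfl⟩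

theorem Realizes.apply {x : ℕ} {b b' v w : Exp} {ρ ρ' : CEnv}
    (hf : Realizes (Exp.lam x b) ρ' (Exp.lam x b')) (hv : Realizes v ρ w) (hval : IsValue v) :
    Realizes b (updA ρ' x (Clo.mk v ρ)) (subst w x b') := by
  have hlookup : ∀ y u ρ₁, lookupA (updA ρ' x (Clo.mk v ρ)) y = some (Clo.mk u ρ₁) →
      IsValue u ∧ ∃ u', Realizes u ρ₁ u' := by
    intro y u ρ₁ hy
    rw [lookupA_updA] at hy
    split_ifs at hy
    · obtain ⟨rfl, rfl⟩ : v = u ∧ ρ = ρ₁ := by simpa using hy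
      exact ⟨hval, w, hv⟩
    · exact hf.env.lookup hy
  refine ⟨.mk _ ?_ ?_, ?_, hf.closed.subst_body hv.closed⟩
  · intro y u ρ₁ hy
    obtain ⟨_, u', hu⟩ := hlookup y u ρ₁ hy
    exact hu.env
  · intro y u ρ₁ hy
    obtain ⟨hu, u', hu'⟩ := hlookup y u ρ₁ hy
    exact ⟨hu, u', hu'.real, hu'.closed⟩
  · cases hf.real with
    | lam _ _ _ _ hb =>
      refine hb.subst ?_ hv.real ?_ ?_ ?_
      · intro y u ρ₁ u' hy hr
        rw [lookupA_eraseA] at hy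
        split_ifs at hy
        obtain ⟨_, u'', hu⟩ := hf.env.lookup hy
        rw [hr.unique hu.real]
        exact hu.closed
      · simp [lookupA_eraseA]
      · simp [lookupA_updA]
      · intro y hy
        simp [lookupA_updA, lookupA_eraseA, hy]

/-- `RealK κ f`: plugging an expression into the continuation `κ`, with all delayed
substitutions performed, is the function `f`. -/
inductive RealK : CKont → (Exp → Exp) → Prop where
  | mt : RealK CKont.mt id
  | ar : ∀ (e : Exp) (ρ : CEnv) (κ : CKont) (e' : Exp) (f : Exp → Exp),
      Realizes e ρ e' → RealK κ f → RealK (CKont.ar e ρ κ) (fun t => f (Exp.app t e'))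
  | fn : ∀ (v : Exp) (ρ : CEnv) (κ : CKont) (v' : Exp) (f : Exp → Exp),
      IsValue v → Realizes v ρ v' → RealK κ f →
      RealK (CKont.fn v ρ κ) (fun t => f (Exp.app v' t))

theorem StdStep.appL {s t : Exp} (h : StdStep s t) (e : Exp) :
    StdStep (Exp.app s e) (Exp.app t e) := by
  cases h with
  | mk E x b v hE hv => exact .mk (Ctx.appL E e) x b v (.appL E e hE) hv

theorem StdStep.appR {s t : Exp} (h : StdStep s t) {v : Exp} (hv : IsValue v) :
    StdStep (Exp.app v s) (Exp.app v t) := by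
  cases h with
  | mk E x b u hE hu => exact .mk (Ctx.appR v E) x b u (.appR v E hv hE) hu

theorem RealK.stdStep {κ : CKont} {f : Exp → Exp} (hκ : RealK κ f) {s t : Exp}
    (h : StdStep s t) : StdStep (f s) (f t) := by
  induction hκ generalizing s t with
  | mt => exact h
  | ar e ρ κ e' f _ _ ih => exact ih (h.appL e')
  | fn v ρ κ v' f hv hr _ ih => exact ih (h.appR (hr.real.isValue hv))

/-! ## The machine simulates only standard reductions -/

/-- The machine state `ς` represents the expression `t`. -/
def Represents (ς : CEKState) (t : Exp) : Prop :=
  ∃ e' f, Realizes ς.exp ς.env e' ∧ RealK ς.kont f ∧ t = f e'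

theorem CEKStep.simulates {ς ς' : CEKState} (h : CEKStep ς ς') {t : Exp}
    (ht : Represents ς t) :
    ∃ t', Represents ς' t' ∧ Relation.ReflTransGen StdStep t t' := by
  obtain ⟨e', f, he, hκ, rfl⟩ := ht
  cases h with
  | var x ρ κ v ρ' hx =>
    obtain ⟨v₁, ρ₁, hx₁, _, hv⟩ := he.var
    obtain ⟨rfl, rfl⟩ : v = v₁ ∧ ρ' = ρ₁ := by simpa [hx₁, eq_comm] using hx
    exact ⟨_, ⟨e', f, hv, hκ, rfl⟩, .refl⟩
  | app e₀ e₁ ρ κ =>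
    obtain ⟨e₀', e₁', rfl, h₀, h₁⟩ := he.app
    exact ⟨_, ⟨e₀', _, h₀, .ar e₁ ρ κ e₁' f h₁ hκ, rfl⟩, .refl⟩
  | ar v ρ e ρ' κ hv =>
    cases hκ with
    | ar _ _ _ e₁ f h₁ hκ => exact ⟨_, ⟨e₁, _, h₁, .fn v ρ κ e' f hv he hκ, rfl⟩, .refl⟩
  | fn v ρ x b ρ' κ hv =>
    cases hκ with
    | fn _ _ _ w f _ hw hκ =>
      obtain ⟨b', rfl⟩ := hw.lam
      exact ⟨_, ⟨_, f, hw.apply he hv, hκ, rfl⟩,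
        .single (hκ.stdStep (.mk Ctx.hole x b' e' .hole (he.real.isValue hv)))⟩

theorem Represents.simulates {ς ς' : CEKState} (h : Relation.ReflTransGen CEKStep ς ς')
    {t : Exp} (ht : Represents ς t) :
    ∃ t', Represents ς' t' ∧ Relation.ReflTransGen StdStep t t' := by
  induction h with
  | refl => exact ⟨t, ht, .refl⟩
  | tail _ hs ih =>
    obtain ⟨t₁, h₁, hr₁⟩ := ih
    obtain ⟨t₂, h₂, hr₂⟩ := hs.simulates h₁
    exact ⟨t₂, h₂, hr₁.trans hr₂⟩

/-! ## Big-step evaluation -/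

/-- Call-by-value big-step evaluation. -/
inductive BigStep : Exp → Exp → Prop where
  | lam : ∀ (x : ℕ) (b : Exp), BigStep (Exp.lam x b) (Exp.lam x b)
  | app : ∀ (e₀ e₁ : Exp) (x : ℕ) (b v v' : Exp),
      BigStep e₀ (Exp.lam x b) → BigStep e₁ v → BigStep (subst v x b) v' →
      BigStep (Exp.app e₀ e₁) v'

theorem BigStep.of_isValue {v : Exp} (hv : IsValue v) : BigStep v v := by
  obtain ⟨x, b, rfl⟩ := hv
  exact .lam x b

theorem BigStep.of_stdStep {s t v : Exp} (h : StdStep s t) (ht : BigStep t v) : BigStep s v := by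
  obtain ⟨E, x, b, u, hE, hu⟩ := h
  clear hE
  induction E generalizing v with
  | hole => exact .app _ _ x b u v (.lam x b) (.of_isValue hu) ht
  | appL E e ih =>
    cases ht with
    | app _ _ y c w _ h₀ h₁ h₂ => exact .app _ _ y c w v (ih h₀) h₁ h₂
  | appR e E ih =>
    cases ht with
    | app _ _ y c w _ h₀ h₁ h₂ => exact .app _ _ y c w v h₀ (ih h₁) h₂

theorem BigStep.of_reflTransGen {e v : Exp} (h : Relation.ReflTransGen StdStep e v)
    (hv : IsValue v) : BigStep e v := by
  induction h using Relation.ReflTransGen.head_induction_on with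
  | refl => exact .of_isValue hv
  | head hs _ ih => exact .of_stdStep hs ih

/-- The machine implements big-step evaluation, in any continuation. -/
theorem BigStep.cek {t v' : Exp} (h : BigStep t v') {e : Exp} {ρ : CEnv}
    (he : Realizes e ρ t) (κ : CKont) :
    ∃ v ρ', IsValue v ∧ Relation.ReflTransGen CEKStep ⟨e, ρ, κ⟩ ⟨v, ρ', κ⟩ ∧
      Realizes v ρ' v' := by
  induction h generalizing e ρ κ with
  | lam x b =>
    cases e with
    | var y =>
      obtain ⟨v, ρ', hy, hv, hr⟩ := he.var
      exact ⟨v, ρ', hv, .single (.var y ρ κ v ρ' hy), hr⟩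
    | app e₀ e₁ =>
      obtain ⟨_, _, h, _⟩ := he.app
      cases h
    | lam y c => exact ⟨_, ρ, ⟨y, c, rfl⟩, .refl, he⟩
  | app t₀ t₁ x b w v' _ _ _ ih₀ ih₁ ih₂ =>
    cases e with
    | var y =>
      obtain ⟨v, ρ', _, hv, hr⟩ := he.var
      obtain ⟨_, _, h⟩ := hr.real.isValue hv
      cases h
    | lam y c =>
      obtain ⟨_, h⟩ := he.lam
      cases h
    | app e₀ e₁ =>
      obtain ⟨_, _, h, h₀, h₁⟩ := he.app
      cases h
      obtain ⟨v₀, ρ₀, hv₀, hs₀, hr₀⟩ := ih₀ h₀ (CKont.ar e₁ ρ κ)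
      obtain ⟨v₁, ρ₁, hv₁, hs₁, hr₁⟩ := ih₁ h₁ (CKont.fn v₀ ρ₀ κ)
      obtain ⟨y, c, rfl⟩ := hv₀
      obtain ⟨_, h⟩ := hr₀.lam
      cases h
      obtain ⟨v, ρ', hv, hs, hr⟩ := ih₂ (hr₀.apply hr₁ hv₁) κ
      refine ⟨v, ρ', hv, ?_, hr⟩
      exact .head (.app e₀ e₁ ρ κ) <| hs₀.trans <| .head (.ar _ ρ₀ e₁ ρ κ ⟨_, _, rfl⟩) <|
        hs₁.trans <| .head (.fn v₁ ρ₁ _ c ρ₀ κ hv₁) hs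

/-- CEK correctness: `eval_CEK = eval`.  The CEK machine
started at `⟨e, ∅, mt⟩` reaches a final state `⟨v, ρ, mt⟩` with
`real(v,ρ) = v'` iff `e` standard-reduces to the value `v'`. -/
theorem cek_correct (e : Exp) (he : Closed e) (v' : Exp) :
    (∃ (v : Exp) (ρ : CEnv), IsValue v ∧
        Relation.ReflTransGen CEKStep (injCEK e) ⟨v, ρ, CKont.mt⟩ ∧
        RealR v ρ v') ↔
      (IsValue v' ∧ Relation.ReflTransGen StdStep e v') := by
  constructor
  · rintro ⟨v, ρ, hv, hs, hr⟩
    obtain ⟨_, ⟨e', f, he', hκ, rfl⟩, ht⟩ :=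
      Represents.simulates hs ⟨e, id, .init he, .mt, rfl⟩
    cases hκ
    rw [he'.real.unique hr] at ht
    exact ⟨hr.isValue hv, ht⟩
  · rintro ⟨hv', h⟩
    obtain ⟨v, ρ, hv, hs, hr⟩ := (BigStep.of_reflTransGen h hv').cek (.init he) CKont.mt
    exact ⟨v, ρ, hv, hs, hr.real⟩
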